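/- arXiv:1509.02591 — 3 statements merged into one kernel-verified Lean document; each statement's English description precedes it below -/
import Mathlib

section
/- Let f : T² → T² be the hyperbolic toral automorphism f(x,y) = (2x+y, x+y). The set C(Fˢ) of continua of T² contained in a single stable leaf of f is a connected (indeed arc-connected) subset of the hyperspace (C(T²), dist_H); the same holds for the set C(Fᵘ) of continua contained in a single unstable leaf. -/
open Metric Set Filter TopologicalSpace

instance : Fact ((0:ℝ) < 1) := ⟨zero_lt_one⟩

/-- The flat torus T² = (ℝ/ℤ) × (ℝ/ℤ). -/
abbrev T2 : Type := AddCircle (1:ℝ) × AddCircle (1:ℝ)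

/-- The quotient map π : ℝ² → T². -/
noncomputable def pr (p : ℝ × ℝ) : T2 := (↑p.1, ↑p.2)

/-- The stable eigenvector v = (1, -(1+√5)/2) of [[2,1],[1,1]]. -/
noncomputable def vs : ℝ × ℝ := (1, -((1 + Real.sqrt 5) / 2))

/-- The unstable eigenvector w = (1, (√5-1)/2) of [[2,1],[1,1]]. -/
noncomputable def vu : ℝ × ℝ := (1, (Real.sqrt 5 - 1) / 2)

/-- The stable leaf through x. -/
noncomputable def stLeaf (x : T2) : Set T2 := range fun t : ℝ => x + pr (t • vs)

/-- The unstable leaf through x. -/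
noncomputable def unLeaf (x : T2) : Set T2 := range fun t : ℝ => x + pr (t • vu)

/-- The hyperspace of continua (nonempty compact connected subsets) of `X`,
with the Hausdorff distance as its metric. -/
abbrev Continua (X : Type*) [MetricSpace X] :=
  {K : TopologicalSpace.NonemptyCompacts X // IsConnected (K : Set X)}

/-- C(Fˢ): the continua of T² contained in a single stable leaf. -/
noncomputable def CFs : Set (Continua T2) := {A | ∃ x : T2, (A.1 : Set T2) ⊆ stLeaf x}

/-- C(Fᵘ): the continua of T² contained in a single unstable leaf. -/
noncomputable def CFu : Set (Continua T2) := {A | ∃ x : T2, (A.1 : Set T2) ⊆ unLeaf x}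

/-- **Boundary bumping**: inside `K ∩ closure V`, some continuum through `x` leaves the open
set `V`. -/
theorem exists_continuum_not_subset {X : Type*} [TopologicalSpace X] [T2Space X] {K V : Set X}
    (hK : IsCompact K) (hKc : IsPreconnected K) (hV : IsOpen V) {x : X} (hx : x ∈ K)
    (hxV : x ∈ V) (hKV : ¬ K ⊆ V) :
    ∃ C ⊆ K ∩ closure V, x ∈ C ∧ IsCompact C ∧ IsConnected C ∧ ¬ C ⊆ V := by
  have hY : IsCompact (K ∩ closure V) := hK.inter_right isClosed_closure
  have : CompactSpace ↥(K ∩ closure V) := isCompact_iff_compactSpace.mp hY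
  set y : ↥(K ∩ closure V) := ⟨x, hx, subset_closure hxV⟩
  refine ⟨Subtype.val '' connectedComponent y, by rintro _ ⟨z, -, rfl⟩; exact z.2,
    ⟨y, mem_connectedComponent, rfl⟩,
    isClosed_connectedComponent.isCompact.image continuous_subtype_val,
    isConnected_connectedComponent.image _ continuous_subtype_val.continuousOn, fun hCV => ?_⟩
  obtain ⟨⟨D, hD, hyD⟩, hDV⟩ : ∃ D : {s : Set ↥(K ∩ closure V) // IsClopen s ∧ y ∈ s},
      (D : Set ↥(K ∩ closure V)) ⊆ Subtype.val ⁻¹' V := by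
    have : Nonempty {s : Set ↥(K ∩ closure V) // IsClopen s ∧ y ∈ s} :=
      ⟨⟨univ, isClopen_univ, mem_univ y⟩⟩
    refine exists_subset_nhds_of_compactSpace (fun s t => ?_) (fun s => s.2.1.1) fun z hz => ?_
    · exact ⟨⟨s ∩ t, s.2.1.inter t.2.1, s.2.2, t.2.2⟩, inter_subset_left, inter_subset_right⟩
    · rw [← connectedComponent_eq_iInter_isClopen] at hz
      exact (hV.preimage continuous_subtype_val).mem_nhds (hCV ⟨z, hz, rfl⟩)
  have hD₁ : IsClosed (Subtype.val '' D : Set X) :=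
    (hD.1.isCompact.image continuous_subtype_val).isClosed
  have hD₂ : IsClosed (Subtype.val '' Dᶜ : Set X) :=
    (hD.compl.1.isCompact.image continuous_subtype_val).isClosed
  obtain ⟨z, hzK, hzV⟩ := not_subset.mp hKV
  obtain ⟨a, -, ⟨b, hb, rfl⟩, hb'⟩ := isPreconnected_closed_iff.mp hKc _ _ hD₁
    (hD₂.union hV.isClosed_compl)
    (fun a ha => by
      by_cases haV : a ∈ V
      · by_cases h : (⟨a, ha, subset_closure haV⟩ : ↥(K ∩ closure V)) ∈ D
        · exact Or.inl ⟨_, h, rfl⟩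
        · exact Or.inr (Or.inl ⟨_, h, rfl⟩)
      · exact Or.inr (Or.inr haV))
    ⟨x, hx, y, hyD, rfl⟩ ⟨z, hzK, Or.inr hzV⟩
  rcases hb' with ⟨c, hc, hcb⟩ | hb'
  · exact hc (Subtype.val_injective hcb ▸ hb)
  · exact hb' (hDV hb)

/-- **Sierpiński's theorem**: a continuum is not the union of countably many, but at least two,
pairwise disjoint nonempty closed sets. -/
theorem exists_subset_of_subset_iUnion_isClosed {X : Type*} [TopologicalSpace X] [T2Space X]
    [CompactSpace X] {F : ℕ → Set X} (hF : ∀ i, IsClosed (F i))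
    (hdisj : Pairwise fun i j => Disjoint (F i) (F j)) {K : Set X} (hK : IsCompact K)
    (hKc : IsConnected K) (hKF : K ⊆ ⋃ i, F i) : ∃ i, K ⊆ F i := by
  by_contra hne
  let S := {L : Set X // L ⊆ K ∧ IsCompact L ∧ IsConnected L ∧ ¬ ∃ i, L ⊆ F i}
  have step : ∀ (i : ℕ) (L : S), ∃ M : S, M.1 ⊆ L.1 ∧ Disjoint M.1 (F i) := by
    rintro i ⟨L, hLK, hL, hLc, hLF⟩
    by_cases hi : Disjoint L (F i)
    · exact ⟨⟨L, hLK, hL, hLc, hLF⟩, subset_rfl, hi⟩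
    obtain ⟨x, hxL, hxi⟩ := not_subset.mp fun h => hLF ⟨i, h⟩
    obtain ⟨j, hxj⟩ := mem_iUnion.mp (hKF (hLK hxL))
    have hij : j ≠ i := by rintro rfl; exact hxi hxj
    obtain ⟨V, hV, hjV, hVi⟩ := normal_exists_closure_subset (hF j) (hF i).isOpen_compl
      (hdisj hij).subset_compl_right
    obtain ⟨z, hzL, hzi⟩ := not_disjoint_iff.mp hi
    obtain ⟨C, hC, hxC, hCcpt, hCc, hCV⟩ := exists_continuum_not_subset hL hLc.isPreconnected hV
      hxL (hjV hxj) fun h => hVi (subset_closure (h hzL)) hzi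
    have hCi : Disjoint C (F i) :=
      disjoint_left.mpr fun a ha => hVi (hC ha).2
    refine ⟨⟨C, fun a ha => hLK (hC ha).1, hCcpt, hCc, ?_⟩, fun a ha => (hC ha).1, hCi⟩
    rintro ⟨k, hk⟩
    obtain rfl : k = j := by
      by_contra hkj
      exact disjoint_left.mp (hdisj hkj) (hk hxC) hxj
    exact hCV (hk.trans hjV)
  choose next hnext hnextF using step
  let L : ℕ → S := fun n => Nat.rec ⟨K, subset_rfl, hK, hKc, hne⟩ (fun i M => next i M) n
  obtain ⟨x, hx⟩ := IsCompact.nonempty_iInter_of_sequence_nonempty_isCompact_isClosed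
    (fun n => (L n).1) (fun n => hnext n (L n)) (fun n => (L n).2.2.2.1.nonempty) hK
    (fun n => (L n).2.2.1.isClosed)
  rw [mem_iInter] at hx
  obtain ⟨i, hi⟩ := mem_iUnion.mp (hKF (hx 0))
  exact disjoint_left.mp (hnextF i (L i)) (hx (i + 1)) hi

/-- A continuum in the image of an injectively immersed line has compact connected preimage,
unless it contains the image of a ray. -/
theorem isCompact_isConnected_preimage {X : Type*} [TopologicalSpace X] [T2Space X]
    [CompactSpace X] {φ : ℝ → X} (hφ : Continuous φ) (hinj : Function.Injective φ) {A : Set X}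
    (hA : IsCompact A) (hAc : IsConnected A) (hAφ : A ⊆ range φ)
    (hup : ∀ a, ∃ t ≥ a, φ t ∉ A) (hdown : ∀ a, ∃ t ≤ a, φ t ∉ A) :
    IsCompact (φ ⁻¹' A) ∧ IsConnected (φ ⁻¹' A) := by
  have hB : IsClosed (φ ⁻¹' A) := hA.isClosed.preimage hφ
  choose c hc hcA using fun n : ℕ => hup n
  choose d hd hdA using fun n : ℕ => hdown (-n)
  let P : ℕ → Set ℝ := fun n => φ ⁻¹' A ∩ (Icc (d n) (c n) ∩ ⋂ m < n, (Ioo (d m) (c m))ᶜ)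
  have hPc : ∀ n, IsCompact (P n) := fun n =>
    (isCompact_Icc.inter_right <| isClosed_iInter fun m => isClosed_iInter fun _ =>
      isOpen_Ioo.isClosed_compl).inter_left hB
  have hIoo : ∀ {n t}, φ t ∈ A → t ∈ Icc (d n) (c n) → t ∈ Ioo (d n) (c n) := fun {n t} htA ht =>
    ⟨ht.1.lt_of_ne (by rintro rfl; exact hdA n htA), ht.2.lt_of_ne (by rintro rfl; exact hcA n htA)⟩
  have hPlt : ∀ m n, m < n → Disjoint (P m) (P n) := fun m n hmn =>
    disjoint_left.mpr fun t htm htn =>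
      mem_iInter₂.mp htn.2.2 m hmn (hIoo htm.1 htm.2.1)
  have hcover : A ⊆ ⋃ n, φ '' P n := by
    classical
    intro x hx
    obtain ⟨t, rfl⟩ := hAφ hx
    have hex : ∃ n, t ∈ Icc (d n) (c n) := by
      obtain ⟨n, hn⟩ := exists_nat_ge |t|
      exact ⟨n, (hd n).trans (by linarith [neg_abs_le t]), (le_abs_self t).trans (hn.trans (hc n))⟩
    refine mem_iUnion.mpr ⟨Nat.find hex, t, ⟨hx, Nat.find_spec hex, ?_⟩, rfl⟩
    exact mem_iInter₂.mpr fun m hm h => Nat.find_min hex hm (Ioo_subset_Icc_self h)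
  obtain ⟨n, hn⟩ := exists_subset_of_subset_iUnion_isClosed
    (fun n => ((hPc n).image hφ).isClosed)
    (fun m n hmn => (disjoint_image_iff hinj).mpr <| hmn.lt_or_gt.elim (hPlt m n)
      fun h => (hPlt n m h).symm) hA hAc hcover
  have hBn : φ ⁻¹' A ⊆ P n := fun t ht => (hinj.mem_set_image).mp (hn ht)
  have hBc : IsCompact (φ ⁻¹' A) := (hPc n).of_isClosed_subset hB hBn
  have himage : φ '' (φ ⁻¹' A) = A := image_preimage_eq_of_subset hAφ
  refine ⟨hBc, .of_image (himage.symm ▸ hAc.nonempty), ?_⟩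
  have : CompactSpace ↥(φ ⁻¹' A) := isCompact_iff_compactSpace.mp hBc
  have hemb : Topology.IsClosedEmbedding fun t : ↥(φ ⁻¹' A) => φ t :=
    (hφ.comp continuous_subtype_val).isClosedEmbedding (hinj.comp Subtype.val_injective)
  rw [← Subtype.coe_image_univ (φ ⁻¹' A), Topology.IsInducing.subtypeVal.isPreconnected_image,
    ← hemb.isInducing.isPreconnected_image, image_univ, range_comp' φ Subtype.val,
    Subtype.range_coe, himage]
  exact hAc.isPreconnected

/-- The linear parametrization of the leaf of slope `α` through `x`. -/
noncomputable def leafMap (α : ℝ) (x : T2) (t : ℝ) : T2 := x + pr (t • ((1 : ℝ), α))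

theorem leafMap_eq (α : ℝ) (x : T2) (t : ℝ) :
    leafMap α x t = (x.1 + (t : AddCircle (1 : ℝ)), x.2 + ((t * α : ℝ) : AddCircle (1 : ℝ))) := by
  ext <;> simp [leafMap, pr]

theorem leafMap_zero (α : ℝ) (x : T2) : leafMap α x 0 = x := by
  ext <;> simp [leafMap_eq]

theorem continuous_leafMap (α : ℝ) (x : T2) : Continuous (leafMap α x) := by
  have h : Continuous ((↑) : ℝ → AddCircle (1 : ℝ)) := AddCircle.continuous_mk' 1
  simp only [funext (leafMap_eq α x)]
  fun_prop

theorem AddCircle.exists_eq_add_intCast {a b : ℝ}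
    (h : (a : AddCircle (1 : ℝ)) = (b : AddCircle (1 : ℝ))) : ∃ n : ℤ, a = b + n := by
  rw [← sub_eq_zero, ← AddCircle.coe_sub, AddCircle.coe_eq_zero_iff] at h
  obtain ⟨n, hn⟩ := h
  exact ⟨n, by simp at hn; linarith⟩

theorem Irrational.eq_zero_of_intCast_mul_eq {α : ℝ} (hα : Irrational α) {m n : ℤ}
    (h : m * α = n) : m = 0 := by
  by_contra hm
  exact (hα.intCast_mul hm).ne_int n h

theorem injective_leafMap {α : ℝ} (hα : Irrational α) (x : T2) :
    Function.Injective (leafMap α x) := by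
  intro s t h
  simp only [leafMap_eq, Prod.mk.injEq, add_right_inj] at h
  obtain ⟨m, hm⟩ := AddCircle.exists_eq_add_intCast h.1
  obtain ⟨n, hn⟩ := AddCircle.exists_eq_add_intCast h.2
  obtain rfl := hα.eq_zero_of_intCast_mul_eq (m := m) (n := n) (by rw [hm] at hn; linarith)
  simpa using hm

/-- A closed subset of a leaf of irrational slope contains no one-sided arithmetic
progression of parameters with nonzero integer step. -/
theorem exists_leafMap_notMem {α : ℝ} (hα : Irrational α) (x : T2) {A : Set T2}
    (hA : IsClosed A) (hAx : A ⊆ range (leafMap α x)) (a : ℝ) {σ : ℤ} (hσ : σ ≠ 0) :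
    ∃ n : ℕ, leafMap α x (a + n * σ) ∉ A := by
  by_contra! hmem
  have hdense : DenseRange (· • ((σ * α : ℝ) : AddCircle (1 : ℝ)) : ℕ → AddCircle (1 : ℝ)) := by
    rw [← denseRange_zsmul_iff_nsmul, AddCircle.denseRange_zsmul_coe_iff, div_one]
    exact hα.intCast_mul hσ
  have hall : ∀ y : AddCircle (1 : ℝ), (x.1 + (a : AddCircle (1 : ℝ)),
      x.2 + ((a * α : ℝ) : AddCircle (1 : ℝ)) + y) ∈ A := by
    refine fun y => hdense.induction_on (p := fun y => (x.1 + (a : AddCircle (1 : ℝ)),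
      x.2 + ((a * α : ℝ) : AddCircle (1 : ℝ)) + y) ∈ A) y (hA.preimage (by fun_prop)) fun n => ?_
    convert hmem n using 1
    rw [leafMap_eq]
    ext
    · simp only [AddCircle.coe_add, add_right_inj, left_eq_add]
      exact AddCircle.coe_eq_zero_iff (1 : ℝ) |>.mpr ⟨n * σ, by simp⟩
    · simp only [← AddCircle.coe_nsmul, add_assoc, ← AddCircle.coe_add, nsmul_eq_mul]
      ring_nf
  obtain ⟨t, ht⟩ := hAx (hall ((α / 2 : ℝ) : AddCircle (1 : ℝ)))
  rw [leafMap_eq, add_assoc, ← AddCircle.coe_add] at ht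
  simp only [Prod.mk.injEq, add_right_inj] at ht
  obtain ⟨m, hm⟩ := AddCircle.exists_eq_add_intCast ht.1
  obtain ⟨n, hn⟩ := AddCircle.exists_eq_add_intCast ht.2
  have := hα.eq_zero_of_intCast_mul_eq (m := 2 * m - 1) (n := 2 * n)
    (by rw [hm] at hn; push_cast; linarith)
  omega

/-- The continua contained in a single leaf of slope `α`. -/
def leafContinua (α : ℝ) : Set (Continua T2) :=
  {A | ∃ x : T2, (A.1 : Set T2) ⊆ range (leafMap α x)}

/-- A point, as a continuum. -/
noncomputable def pointContinuum (x : T2) : Continua T2 :=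
  ⟨{x}, by simpa using isConnected_singleton⟩

theorem pointContinuum_mem (α : ℝ) (x : T2) : pointContinuum x ∈ leafContinua α :=
  ⟨x, by simpa [pointContinuum] using ⟨0, leafMap_zero α x⟩⟩

theorem joinedIn_pointContinuum (α : ℝ) (x y : T2) :
    JoinedIn (leafContinua α) (pointContinuum x) (pointContinuum y) := by
  have hc : Continuous pointContinuum :=
    NonemptyCompacts.continuous_singleton.subtype_mk _
  have : PathConnectedSpace (AddCircle (1 : ℝ)) :=
    (Quotient.mk_surjective (s := QuotientAddGroup.leftRel (AddSubgroup.zmultiples (1 : ℝ)))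
      ).pathConnectedSpace (AddCircle.continuous_mk' (1 : ℝ))
  obtain ⟨γ⟩ := PathConnectedSpace.joined x y
  exact ⟨γ.map hc, fun t => pointContinuum_mem α _⟩

/-- Contracting the leaf parameter joins a continuum in a leaf to a point. -/
theorem joinedIn_of_mem_leafContinua {α : ℝ} (hα : Irrational α) {A : Continua T2} {x : T2}
    (hA : (A.1 : Set T2) ⊆ range (leafMap α x)) :
    JoinedIn (leafContinua α) (pointContinuum x) A := by
  have hray {σ : ℤ} (hσ : σ ≠ 0) (a : ℝ) :=
    exists_leafMap_notMem hα x A.1.isCompact.isClosed hA a hσ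
  obtain ⟨hBc, hBconn⟩ := isCompact_isConnected_preimage (continuous_leafMap α x)
    (injective_leafMap hα x) A.1.isCompact A.2 hA
    (fun a => let ⟨n, hn⟩ := hray one_ne_zero a; ⟨_, by simp, hn⟩)
    (fun a => let ⟨n, hn⟩ := hray (neg_ne_zero.mpr one_ne_zero) a; ⟨_, by simp, hn⟩)
  let B : NonemptyCompacts ℝ := ⟨⟨leafMap α x ⁻¹' A.1, hBc⟩, hBconn.nonempty⟩
  have hcont (s : ℝ) : Continuous fun t => leafMap α x (s * t) :=
    (continuous_leafMap α x).comp (continuous_const_mul s)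
  let γ (s : ℝ) : Continua T2 := ⟨B.map _ (hcont s), by
    rw [NonemptyCompacts.coe_map]
    exact hBconn.image _ (hcont s).continuousOn⟩
  have hγ : Continuous γ := Continuous.subtype_mk
    (Continuous.nonemptyCompacts_map' (g := fun s t => leafMap α x (s * t)) continuous_const
      ((continuous_leafMap α x).comp continuous_mul)) _
  refine JoinedIn.ofLine hγ.continuousOn ?_ ?_ ?_
  · refine Subtype.ext (SetLike.coe_injective ?_)
    simp only [γ, pointContinuum, NonemptyCompacts.coe_map, zero_mul, leafMap_zero]
    exact B.nonempty.image_const x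
  · refine Subtype.ext (SetLike.coe_injective ?_)
    simp only [γ, NonemptyCompacts.coe_map, one_mul]
    exact image_preimage_eq_of_subset hA
  · rintro _ ⟨s, -, rfl⟩
    refine ⟨x, ?_⟩
    simp only [γ, NonemptyCompacts.coe_map]
    rintro _ ⟨t, -, rfl⟩
    exact mem_range_self _

theorem isPathConnected_leafContinua {α : ℝ} (hα : Irrational α) :
    IsPathConnected (leafContinua α) :=
  ⟨pointContinuum 0, pointContinuum_mem α 0, fun {_} ⟨x, hx⟩ =>
    (joinedIn_pointContinuum α 0 x).trans (joinedIn_of_mem_leafContinua hα hx)⟩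

/-- C(Fˢ) and C(Fᵘ) are connected (indeed arc-connected, formalized as
path-connected) subsets of the hyperspace (C(T²), dist_H). -/
theorem CFs_CFu_connected :
    (IsConnected CFs ∧ IsPathConnected CFs) ∧ (IsConnected CFu ∧ IsPathConnected CFu) := by
  have hs : IsPathConnected CFs :=
    isPathConnected_leafContinua (α := -((1 + Real.sqrt 5) / 2)) Real.goldenRatio_irrational.neg
  have hu : IsPathConnected CFu :=
    isPathConnected_leafContinua (α := (Real.sqrt 5 - 1) / 2) <| by
      convert Real.goldenConj_irrational.neg using 1
      rw [Real.goldenConj]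
      ring
  exact ⟨⟨hs.isConnected, hs⟩, hu.isConnected, hu⟩
end

section
/- Let f : T² → T² be the hyperbolic toral automorphism f(x,y) = (2x+y, x+y) and let A = A(x,L) = {x + π(t·v) : t ∈ [0,L]} be a stable arc with L > 0. Then f^{-n}(A) converges to T² in the Hausdorff metric as n → +∞, i.e. dist_H(f^{-n}(A), T²) → 0. -/
open Metric Set Filter TopologicalSpace

/-- The hyperbolic toral automorphism f(x,y) = (2x+y, x+y). -/
noncomputable def fA (p : T2) : T2 := (p.1 + p.1 + p.2, p.1 + p.2)

/-- The stable arc A(x,L) = {x + π(t·v) : t ∈ [0,L]}. -/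
noncomputable def stArc (x : T2) (L : ℝ) : Set T2 := (fun t : ℝ => x + pr (t • vs)) '' Icc 0 L

/-- If the integer multiples of `a` are dense in a compact group, then boundedly many natural
multiples of `a` are already `ε`-dense. -/
theorem DenseRange.exists_nsmul_dist_lt {G : Type*} [SeminormedAddCommGroup G] [CompactSpace G]
    {a : G} (ha : DenseRange (· • a : ℤ → G)) {ε : ℝ} (hε : 0 < ε) :
    ∃ N : ℕ, ∀ c : G, ∃ k ≤ N, dist (k • a) c < ε := by
  obtain ⟨s, hs⟩ := isCompact_univ.elim_finite_subcover (fun k : ℤ => ball (k • a) ε)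
    (fun _ => isOpen_ball) (fun c _ => by
      obtain ⟨k, hk⟩ := ha.exists_dist_lt c hε
      exact mem_iUnion.2 ⟨k, hk⟩)
  set K : ℕ := s.sup Int.natAbs
  refine ⟨2 * K, fun c => ?_⟩
  obtain ⟨k, hks, hk⟩ := mem_iUnion₂.1 (hs (mem_univ (c - K • a)))
  have hkK : k.natAbs ≤ K := Finset.le_sup (f := Int.natAbs) hks
  refine ⟨(k + K).toNat, by omega, ?_⟩
  have hnat : (k + K).toNat • a = k • a + K • a := by
    rw [← natCast_zsmul, Int.toNat_of_nonneg (by omega), add_smul, natCast_zsmul]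
  rw [mem_ball, dist_comm, dist_eq_norm] at hk
  rw [hnat, dist_eq_norm]
  convert hk using 2
  abel

open Real goldenRatio in
theorem vs_eq : vs = (1, -φ) := rfl

open Real goldenRatio in
/-- The stable line through any point comes `ε`-close to every other point within bounded time. -/
theorem exists_stable_time {ε : ℝ} (hε : 0 < ε) :
    ∃ T : ℝ, 0 < T ∧ ∀ y z : T2, ∃ t ∈ Icc 0 T, dist (y + pr (t • vs)) z < ε := by
  have hd : DenseRange (· • ((-φ : ℝ) : AddCircle (1 : ℝ)) : ℤ → AddCircle (1 : ℝ)) := by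
    rw [AddCircle.denseRange_zsmul_coe_iff, div_one]
    exact goldenRatio_irrational.neg
  obtain ⟨N, hN⟩ := hd.exists_nsmul_dist_lt hε
  refine ⟨N + 1, by positivity, fun y z => ?_⟩
  obtain ⟨s, hs, hsz⟩ := (AddCircle.coe_image_Icc_eq (1 : ℝ) 0).ge (mem_univ (z.1 - y.1))
  rw [zero_add] at hs
  obtain ⟨k, hkN, hk⟩ := hN (z.2 - y.2 - ((s * -φ : ℝ) : AddCircle (1 : ℝ)))
  have hkN' : (k : ℝ) ≤ N := by exact_mod_cast hkN
  refine ⟨s + k, ⟨by linarith [hs.1, k.cast_nonneg (α := ℝ)], by linarith [hs.2]⟩, ?_⟩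
  rw [Prod.dist_eq, max_lt_iff]
  constructor
  · have : ((k : ℝ) : AddCircle (1 : ℝ)) = 0 := by
      rw [← nsmul_one, AddCircle.coe_nsmul, AddCircle.coe_period, smul_zero]
    have h : (y + pr ((s + k) • vs)).1 = z.1 := by
      simp [pr, vs_eq, this, hsz]
    rwa [h, dist_self]
  · have h : (y + pr ((s + k) • vs)).2 =
        y.2 + ((s * -φ : ℝ) : AddCircle (1 : ℝ)) + k • ((-φ : ℝ) : AddCircle (1 : ℝ)) := by
      rw [← AddCircle.coe_nsmul, add_assoc, ← AddCircle.coe_add, nsmul_eq_mul, ← add_mul]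
      rfl
    have hsub (a b c d : AddCircle (1 : ℝ)) : a + b + c - d = c - (d - a - b) := by abel
    rw [dist_eq_norm] at hk ⊢
    rwa [h, hsub]

theorem fA_surjective : Function.Surjective fA := fun p =>
  ⟨(p.1 - p.2, p.2 + p.2 - p.1), by ext <;> simp only [fA] <;> abel⟩

theorem fA_add (p q : T2) : fA (p + q) = fA p + fA q := by
  ext <;> simp only [fA, Prod.fst_add, Prod.snd_add] <;> abel

open Real goldenRatio in
theorem fA_pr_smul_vs (t : ℝ) : fA (pr (t • vs)) = pr (((2 - φ) * t) • vs) := by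
  have h : pr (((2 - φ) * t) • vs) = pr (t + t + t * -φ, t + t * -φ) := by
    congr 1
    ext
    · simp [vs_eq]; ring
    · simp [vs_eq]; linear_combination t * goldenRatio_sq
  rw [h]
  simp [fA, pr, vs_eq]

open Real goldenRatio in
theorem fA_iterate_add_pr_smul_vs (n : ℕ) (y : T2) (t : ℝ) :
    fA^[n] (y + pr (t • vs)) = fA^[n] y + pr (((2 - φ) ^ n * t) • vs) := by
  induction n generalizing y t with
  | zero => simp
  | succ n ih =>
    rw [Function.iterate_succ_apply, fA_add, fA_pr_smul_vs, ih, Function.iterate_succ_apply,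
      pow_succ, mul_assoc]

/-- The negative iterates f^{-n}(A) of a nontrivial stable arc A = A(x,L)
converge to the whole torus in the Hausdorff metric: dist_H(f^{-n}(A), T²) → 0. -/
theorem stable_arc_negative_iterates_tendsto_torus (x : T2) (L : ℝ) (hL : 0 < L) :
    Tendsto (fun n : ℕ => hausdorffDist (fA^[n] ⁻¹' stArc x L) (univ : Set T2))
      atTop (nhds 0) := by
  rw [Metric.tendsto_atTop]
  intro ε hε
  obtain ⟨T, hT, hdense⟩ := exists_stable_time (half_pos hε)
  have hl0 : 0 < 2 - Real.goldenRatio := sub_pos.2 Real.goldenRatio_lt_two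
  have hl1 : 2 - Real.goldenRatio < 1 := by linarith [Real.one_lt_goldenRatio]
  obtain ⟨M, hM⟩ := exists_pow_lt_of_lt_one (div_pos hL hT) hl1
  refine ⟨M, fun n hn => ?_⟩
  have hnT : (2 - Real.goldenRatio) ^ n * T ≤ L := by
    rw [← le_div_iff₀ hT]
    exact (pow_le_pow_of_le_one hl0.le hl1.le hn).trans hM.le
  obtain ⟨y, hy⟩ := fA_surjective.iterate n x
  rw [Real.dist_0_eq_abs, abs_of_nonneg hausdorffDist_nonneg]
  refine lt_of_le_of_lt (hausdorffDist_le_of_mem_dist (half_pos hε).le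
    (fun p _ => ⟨p, mem_univ p, by simpa using (half_pos hε).le⟩) fun z _ => ?_) (half_lt_self hε)
  obtain ⟨t, ht, htz⟩ := hdense y z
  refine ⟨y + pr (t • vs), ?_, by rw [dist_comm]; exact htz.le⟩
  rw [mem_preimage, fA_iterate_add_pr_smul_vs, hy]
  exact ⟨_, ⟨mul_nonneg (pow_nonneg hl0.le n) ht.1,
    (mul_le_mul_of_nonneg_left ht.2 (pow_nonneg hl0.le n)).trans hnT⟩, rfl⟩
end

section
/- Let X be a compact connected metric space and A ⊆ X a continuum. Then i(A), the set of all subcontinua of A, is a nonempty compact connected subset of the hyperspace (C(X), dist_H); that is, i(A) is a hypercontinuum (an element of C²(X)). -/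
open Metric Set Filter TopologicalSpace

variable {X : Type*} [MetricSpace X]

/-- i(A): the set of subcontinua of A, as a subset of the hyperspace. -/
def iSet (A : Continua X) : Set (Continua X) := {B | (B.1 : Set X) ⊆ (A.1 : Set X)}

/-- In a compact Hausdorff space, a neighbourhood of a connected component contains a clopen
neighbourhood of it. -/
theorem exists_isClopen_of_connectedComponent_subset {Y : Type*} [TopologicalSpace Y]
    [CompactSpace Y] [T2Space Y] {p : Y} {V : Set Y} (hV : IsOpen V)
    (h : connectedComponent p ⊆ V) : ∃ W : Set Y, IsClopen W ∧ p ∈ W ∧ W ⊆ V := by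
  rw [connectedComponent_eq_iInter_isClopen] at h
  have : Nonempty {s : Set Y // IsClopen s ∧ p ∈ s} := ⟨⟨univ, isClopen_univ, mem_univ p⟩⟩
  obtain ⟨W, hW⟩ := exists_subset_nhds_of_compactSpace
    (V := fun s : {s : Set Y // IsClopen s ∧ p ∈ s} => (s : Set Y))
    (fun s t => ⟨⟨s ∩ t, s.2.1.inter t.2.1, s.2.2, t.2.2⟩, inter_subset_left, inter_subset_right⟩)
    (fun s => s.2.1.1) (U := V) (fun x hx => hV.mem_nhds (h hx))
  exact ⟨W, W.2.1, W.2.2, hW⟩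

/-- Boundary bumping: a proper connected subset `L` of a continuum `K` can be enlarged
within `K` to a connected set that stays in a given closed neighbourhood `C` of `L`. -/
theorem exists_isConnected_ssubset_of_subset_interior {Y : Type*} [TopologicalSpace Y] [T2Space Y]
    {K L C : Set Y} (hK : IsCompact K) (hKc : IsPreconnected K) (hL : IsConnected L)
    (hLK : L ⊂ K) (hC : IsClosed C) (hLC : L ⊆ interior C) :
    ∃ M : Set Y, IsCompact M ∧ IsConnected M ∧ L ⊂ M ∧ M ⊆ K ∩ C := by
  obtain ⟨p, hp⟩ := hL.nonempty
  have hLN : L ⊆ K ∩ C := subset_inter hLK.subset (hLC.trans interior_subset)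
  have hN : IsCompact (K ∩ C) := hK.inter_right hC
  have hpN := hLN hp
  have : CompactSpace ↥(K ∩ C) := isCompact_iff_compactSpace.mp hN
  have hM : IsCompact (connectedComponentIn (K ∩ C) p) := by
    rw [connectedComponentIn_eq_image hpN]
    exact isClosed_connectedComponent.isCompact.image continuous_subtype_val
  refine ⟨connectedComponentIn (K ∩ C) p, hM, isConnected_connectedComponentIn_iff.mpr hpN,
    ⟨hL.isPreconnected.subset_connectedComponentIn hp hLN, fun hML => ?_⟩,
    connectedComponentIn_subset _ _⟩
  have hsub : connectedComponent (⟨p, hpN⟩ : ↥(K ∩ C)) ⊆ Subtype.val ⁻¹' interior C := by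
    rw [← image_subset_iff, ← connectedComponentIn_eq_image hpN]
    exact hML.trans hLC
  obtain ⟨W, hW, hpW, hWC⟩ := exists_isClopen_of_connectedComponent_subset
    (isOpen_interior.preimage continuous_subtype_val) hsub
  obtain ⟨O, hO, rfl⟩ := isOpen_induced_iff.mp hW.isOpen
  have hF : IsClosed (Subtype.val '' (Subtype.val ⁻¹' O : Set ↥(K ∩ C))) :=
    hN.isClosed.isClosedEmbedding_subtypeVal.isClosedMap _ hW.isClosed
  have hKO : K ⊆ O ∩ interior C := by
    refine (isPreconnected_iff_subset_of_disjoint.mp hKc _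
      (Subtype.val '' (Subtype.val ⁻¹' O : Set ↥(K ∩ C)))ᶜ
      (hO.inter isOpen_interior) hF.isOpen_compl (fun x hx => ?_) ?_).resolve_right
      fun h => h hpN.1 ⟨⟨p, hpN⟩, hpW, rfl⟩
    · by_cases hxW : x ∈ Subtype.val '' (Subtype.val ⁻¹' O : Set ↥(K ∩ C))
      · obtain ⟨z, hz, rfl⟩ := hxW
        exact Or.inl ⟨hz, hWC hz⟩
      · exact Or.inr hxW
    · refine eq_empty_iff_forall_notMem.mpr fun x hx => ?_
      exact hx.2.2 ⟨⟨x, hx.1, interior_subset hx.2.1.2⟩, hx.2.1.1, rfl⟩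
  have hKC : K ∩ C = K := inter_eq_left.mpr fun x hx => interior_subset (hKO hx).2
  rw [hKC, hKc.connectedComponentIn hpN.1] at hML
  exact hLK.not_subset hML

/-- In a Hausdorff space, the connected sets form a closed subset of the hyperspace of nonempty
compact sets. -/
theorem isClosed_setOf_isConnected_nonemptyCompacts {Y : Type*} [TopologicalSpace Y] [T2Space Y] :
    IsClosed {K : NonemptyCompacts Y | IsConnected (K : Set Y)} := by
  rw [← isOpen_compl_iff, isOpen_iff_mem_nhds]
  intro K hK
  have hK' : ¬ IsPreconnected (K : Set Y) := fun h => hK ⟨K.nonempty, h⟩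
  rw [isPreconnected_iff_subset_of_fully_disjoint_closed K.isCompact.isClosed] at hK'
  push Not at hK'
  obtain ⟨a, b, ha, hb, hab, hdisj, hna, hnb⟩ := hK'
  obtain ⟨u, v, hu, hv, hau, hbv, huv⟩ := SeparatedNhds.of_isCompact_isCompact
    (K.isCompact.inter_right ha) (K.isCompact.inter_right hb)
    (hdisj.mono inter_subset_right inter_subset_right)
  obtain ⟨x, hxK, hxa⟩ := not_subset.mp hna
  obtain ⟨y, hyK, hyb⟩ := not_subset.mp hnb
  have hmem : {L : NonemptyCompacts Y | (L : Set Y) ⊆ u ∪ v} ∩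
      ({L | ((L : Set Y) ∩ u).Nonempty} ∩ {L | ((L : Set Y) ∩ v).Nonempty}) ∈ nhds K :=
    ((NonemptyCompacts.isOpen_subsets_of_isOpen (hu.union hv)).inter
      ((NonemptyCompacts.isOpen_inter_nonempty_of_isOpen hu).inter
        (NonemptyCompacts.isOpen_inter_nonempty_of_isOpen hv))).mem_nhds
      ⟨fun z hz => (hab hz).imp (fun h => hau ⟨hz, h⟩) fun h => hbv ⟨hz, h⟩,
        ⟨y, hyK, hau ⟨hyK, (hab hyK).resolve_right hyb⟩⟩,
        ⟨x, hxK, hbv ⟨hxK, (hab hxK).resolve_left hxa⟩⟩⟩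
  filter_upwards [hmem] with L hL hLc
  obtain ⟨z, -, hzu, hzv⟩ := hLc.isPreconnected u v hu hv hL.1 hL.2.1 hL.2.2
  exact huv.le_bot ⟨hzu, hzv⟩

/-- A closed compact subset of an ordered space with closed upper rays has a maximal element
above each of its elements. -/
theorem IsCompact.exists_le_maximal {α : Type*} [TopologicalSpace α] [PartialOrder α]
    [ClosedIciTopology α] {s : Set α} (hs : IsCompact s) (hs' : IsClosed s) {x : α} (hx : x ∈ s) :
    ∃ m, x ≤ m ∧ Maximal (· ∈ s) m := by
  refine zorn_le_nonempty₀ s (fun c hcs hc y hy => ?_) x hx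
  have : Nonempty c := ⟨⟨y, hy⟩⟩
  obtain ⟨b, hb⟩ := IsCompact.nonempty_iInter_of_directed_nonempty_isCompact_isClosed
    (fun z : c => s ∩ Ici (z : α))
    (fun z w => (hc.total z.2 w.2).elim
      (fun h => ⟨w, inter_subset_inter_right _ (Ici_subset_Ici.mpr h), subset_rfl⟩)
      fun h => ⟨z, subset_rfl, inter_subset_inter_right _ (Ici_subset_Ici.mpr h)⟩)
    (fun z => ⟨z, hcs z.2, le_rfl⟩) (fun z => hs.inter_right isClosed_Ici)
    (fun z => hs'.inter isClosed_Ici)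
  rw [mem_iInter] at hb
  exact ⟨b, (hb ⟨y, hy⟩).1, fun z hz => (hb ⟨z, hz⟩).2⟩

instance Continua.instClosedIciTopology : ClosedIciTopology (Continua X) where
  isClosed_Ici A := by
    have : Ici A = Subtype.val ⁻¹'
        ⋂ x ∈ A.1, {K : NonemptyCompacts X | ((K : Set X) ∩ {x}).Nonempty} := by
      ext B
      simp only [mem_Ici, mem_preimage, mem_iInter, inter_singleton_nonempty, mem_ofPred_eq]
      rfl
    rw [this]
    exact (isClosed_biInter fun x _ =>
      NonemptyCompacts.isClosed_inter_nonempty_of_isClosed isClosed_singleton).preimage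
        continuous_subtype_val

instance Continua.instCompactSpace [CompactSpace X] : CompactSpace (Continua X) :=
  isCompact_iff_compactSpace.mp isClosed_setOf_isConnected_nonemptyCompacts.isCompact

theorem isClosed_iSet (A : Continua X) : IsClosed (iSet A) :=
  (NonemptyCompacts.isClosed_subsets_of_isClosed A.1.isCompact.isClosed).preimage
    continuous_subtype_val

/-- A proper subcontinuum `L` of a continuum `A` can be enlarged within `A` by arbitrarily little. -/
theorem exists_gt_mem_iSet_dist_le {A L : Continua X} (hLA : L < A) {ε : ℝ} (hε : 0 < ε) :
    ∃ M, L < M ∧ M ∈ iSet A ∧ dist M L ≤ ε := by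
  obtain ⟨M, hM, hMc, hLM, hMK⟩ := exists_isConnected_ssubset_of_subset_interior
    A.1.isCompact A.2.isPreconnected L.2 (show (L.1 : Set X) ⊂ A.1 from hLA)
    (isClosed_cthickening (δ := ε) (E := (L.1 : Set X)))
    ((self_subset_thickening hε _).trans (thickening_subset_interior_cthickening _ _))
  refine ⟨⟨⟨⟨M, hM⟩, hMc.nonempty⟩, hMc⟩, hLM, hMK.trans inter_subset_left, ?_⟩
  refine hausdorffDist_le_of_mem_dist hε.le (fun x hx => ?_)
    fun x hx => ⟨x, hLM.subset hx, by simpa using hε.le⟩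
  have hx' : x ∈ cthickening ε (L.1 : Set X) := (hMK hx).2
  rw [L.1.isCompact.cthickening_eq_biUnion_closedBall hε.le] at hx'
  simpa using hx'

theorem iSet_subset_of_mem [CompactSpace X] {A : Continua X} {u v : Set (Continua X)}
    (hu : IsClosed u) (hv : IsClosed v) (huv : iSet A ⊆ u ∪ v) (hdisj : iSet A ∩ (u ∩ v) = ∅)
    (hA : A ∈ u) : iSet A ⊆ u := by
  intro B hB
  by_contra hBu
  have hs : IsClosed (iSet A ∩ v) := (isClosed_iSet A).inter hv
  obtain ⟨L, -, hL⟩ := hs.isCompact.exists_le_maximal hs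
    (show B ∈ iSet A ∩ v from ⟨hB, (huv hB).resolve_left hBu⟩)
  have hLu : L ∉ u := fun h => (hdisj.subset ⟨hL.prop.1, h, hL.prop.2⟩).elim
  have hLA : L < A := lt_of_le_of_ne hL.prop.1 fun h => hLu (h ▸ hA)
  obtain ⟨ε, hε, hball⟩ := nhds_basis_closedBall.mem_iff.mp (hu.isOpen_compl.mem_nhds hLu)
  obtain ⟨M, hLM, hMA, hM⟩ := exists_gt_mem_iSet_dist_le hLA hε
  exact hL.not_prop_of_gt hLM ⟨hMA, (huv hMA).resolve_left (hball hM)⟩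

/-- For a continuum A in a compact connected metric space X, the set i(A) of all
subcontinua of A is a nonempty compact connected subset of the hyperspace
(C(X), dist_H), i.e. a hypercontinuum. -/
theorem iSet_isCompact_isConnected [CompactSpace X] [ConnectedSpace X] (A : Continua X) :
    (iSet A).Nonempty ∧ IsCompact (iSet A) ∧ IsConnected (iSet A) := by
  have hA : A ∈ iSet A := subset_rfl (a := (A.1 : Set X))
  refine ⟨⟨A, hA⟩, (isClosed_iSet A).isCompact, ⟨A, hA⟩, ?_⟩
  rw [isPreconnected_iff_subset_of_disjoint_closed]
  intro u v hu hv huv hdisj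
  exact (huv hA).imp (iSet_subset_of_mem hu hv huv hdisj)
    (iSet_subset_of_mem hv hu (union_comm u v ▸ huv) (inter_comm u v ▸ hdisj))
end
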